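/- arXiv:2310.18841 — 3 statements merged into one kernel-verified Lean document; each statement's English description precedes it below -/
import Mathlib

section
/- Let f : ℝ^d → ℝ be differentiable with L-Lipschitz gradient, L > 0. Let ε_g > 0 and x, g ∈ ℝ^d satisfy ‖g‖ > ε_g and ‖g − ∇f(x)‖ ≤ (1/3)·max{ε_g, ‖g‖}. Then f(x − (1/L)·g) ≤ f(x) − ‖g‖²/(6L) ≤ f(x) − ε_g²/(6L). -/
/-- The descent lemma: a function with `L`-Lipschitz gradient is bounded above by its
first-order expansion plus `L / 2` times the squared displacement. -/
theorem le_add_inner_gradient_add_sq_of_lipschitz {E : Type*} [NormedAddCommGroup E]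
    [InnerProductSpace ℝ E] [CompleteSpace E] {f : E → ℝ} (hf : Differentiable ℝ f) {L : ℝ}
    (hLip : ∀ x₁ x₂ : E, ‖gradient f x₁ - gradient f x₂‖ ≤ L * ‖x₁ - x₂‖) (x v : E) :
    f (x + v) ≤ f x + inner ℝ (gradient f x) v + L / 2 * ‖v‖ ^ 2 := by
  have hφ : ∀ t : ℝ, HasDerivAt (fun s : ℝ => f (x + s • v))
      (inner ℝ (gradient f (x + t • v)) v) t := by
    intro t
    have h₁ : HasDerivAt (fun s : ℝ => x + s • v) v t := by
      simpa using ((hasDerivAt_id t).smul_const v).const_add x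
    exact (hf (x + t • v)).hasGradientAt.hasFDerivAt.comp_hasDerivAt t h₁
  have hB : ∀ t : ℝ, HasDerivAt
      (fun s : ℝ => f x + s * inner ℝ (gradient f x) v + L / 2 * ‖v‖ ^ 2 * s ^ 2)
      (inner ℝ (gradient f x) v + L * t * ‖v‖ ^ 2) t := by
    intro t
    have h := (((hasDerivAt_id t).mul_const (inner ℝ (gradient f x) v)).const_add (f x)).add
      ((hasDerivAt_pow 2 t).const_mul (L / 2 * ‖v‖ ^ 2))
    refine h.congr_deriv ?_
    push_cast
    ring
  have key := image_le_of_deriv_right_le_deriv_boundary (a := 0) (b := 1)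
    (fun t _ => (hφ t).continuousAt.continuousWithinAt)
    (fun t _ => (hφ t).hasDerivWithinAt) (by simp)
    (fun t _ => (hB t).continuousAt.continuousWithinAt)
    (fun t _ => (hB t).hasDerivWithinAt)
    (fun t ht => by
      have h₁ := real_inner_le_norm (gradient f (x + t • v) - gradient f x) v
      have h₂ := hLip (x + t • v) x
      rw [add_sub_cancel_left, norm_smul, Real.norm_of_nonneg ht.1] at h₂
      rw [inner_sub_left] at h₁
      nlinarith [mul_le_mul_of_nonneg_right h₂ (norm_nonneg v)])
    (Set.right_mem_Icc.2 zero_le_one)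
  simpa using key

theorem gradient_step_descent {d : ℕ} (f : EuclideanSpace ℝ (Fin d) → ℝ)
    (hf : Differentiable ℝ f) (L : ℝ) (hL : 0 < L)
    (hLip : ∀ x₁ x₂ : EuclideanSpace ℝ (Fin d),
      ‖gradient f x₁ - gradient f x₂‖ ≤ L * ‖x₁ - x₂‖)
    (εg : ℝ) (hεg : 0 < εg) (x g : EuclideanSpace ℝ (Fin d))
    (hglarge : εg < ‖g‖)
    (hg : ‖g - gradient f x‖ ≤ (1/3) * max εg ‖g‖) :
    f (x - (1/L) • g) ≤ f x - ‖g‖^2 / (6*L) ∧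
      f x - ‖g‖^2 / (6*L) ≤ f x - εg^2 / (6*L) := by
  constructor
  · have h := le_add_inner_gradient_add_sq_of_lipschitz hf hLip x (-((1/L) • g))
    rw [← sub_eq_add_neg, inner_neg_right, real_inner_smul_right, norm_neg, norm_smul,
      Real.norm_of_nonneg (by positivity)] at h
    rw [max_eq_right hglarge.le] at hg
    have h₁ := real_inner_le_norm (g - gradient f x) g
    rw [inner_sub_left, real_inner_self_eq_norm_sq] at h₁
    have h₂ : 2 / 3 * ‖g‖ ^ 2 ≤ inner ℝ (gradient f x) g := by
      nlinarith [mul_le_mul_of_nonneg_right hg (norm_nonneg g)]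
    have h₃ := mul_le_mul_of_nonneg_left h₂ (show 0 ≤ 1 / L by positivity)
    have h₄ : L / 2 * (1 / L * ‖g‖) ^ 2 - 1 / L * (2 / 3 * ‖g‖ ^ 2) = -(‖g‖ ^ 2 / (6 * L)) := by
      field_simp
      ring
    linarith
  · gcongr
end

section
/- Let L, M, α, ε_g, ε_H > 0, let f̄ ∈ ℝ, let K be a positive integer, set C_ε := min{ε_g²/(6L), 2ε_H³/(9M²)} and B := 1 + 18αL/(M·ε_g), and let n be an integer with n ≥ 2·(f₀ − f̄)/C_ε + B·K. Let f₀, f₁, …, f_n be real numbers with f₀ ≥ f̄ and f_n ≥ f̄, and suppose {0, 1, …, n−1} is partitioned into two sets NC and GD such that f_k − f_{k+1} ≥ −8αε_g/(3M) for every k ∈ NC and f_k − f_{k+1} ≥ ε_g²/(6L) for every k ∈ GD. Then |NC| ≥ K. -/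
theorem nc_step_count_lower_bound (L M α εg εH : ℝ) (hL : 0 < L) (hM : 0 < M)
    (hα : 0 < α) (hεg : 0 < εg) (hεH : 0 < εH)
    (fbar : ℝ) (K : ℕ) (hK : 0 < K)
    (Cε B : ℝ) (hCε : Cε = min (εg^2 / (6*L)) (2 * εH^3 / (9 * M^2)))
    (hB : B = 1 + 18 * α * L / (M * εg))
    (n : ℕ) (f : ℕ → ℝ)
    (hn : 2 * (f 0 - fbar) / Cε + B * K ≤ (n : ℝ))
    (hf0 : fbar ≤ f 0) (hfn : fbar ≤ f n)
    (NC GD : Finset ℕ) (hunion : NC ∪ GD = Finset.range n) (hdisj : Disjoint NC GD)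
    (hNC : ∀ k ∈ NC, -(8 * α * εg / (3 * M)) ≤ f k - f (k+1))
    (hGD : ∀ k ∈ GD, εg^2 / (6*L) ≤ f k - f (k+1)) :
    K ≤ NC.card := by
  have hg : 0 < εg ^ 2 / (6 * L) := by positivity
  have hr : 0 < α * L / (M * εg) := by positivity
  have ha : 8 * α * εg / (3 * M) = 16 * (α * L / (M * εg)) * (εg ^ 2 / (6 * L)) := by
    field_simp
    norm_num
  have hB' : B = 1 + 18 * (α * L / (M * εg)) := by rw [hB]; ring
  have hC : 0 < Cε := by rw [hCε]; exact lt_min hg (by positivity)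
  have hCg : Cε ≤ εg ^ 2 / (6 * L) := hCε ▸ min_le_left _ _
  rw [ha] at hNC
  generalize εg ^ 2 / (6 * L) = g at *
  generalize α * L / (M * εg) = r at *
  have hcard : (NC.card : ℝ) + GD.card = n := by
    rw [← Nat.cast_add, ← Finset.card_union_of_disjoint hdisj, hunion, Finset.card_range]
  have hdecrease : -(16 * r * g) * NC.card + g * GD.card ≤ f 0 - f n := by
    rw [← Finset.sum_range_sub', ← hunion, Finset.sum_union hdisj]
    have h₁ := Finset.card_nsmul_le_sum NC _ _ hNC
    have h₂ := Finset.card_nsmul_le_sum GD _ _ hGD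
    rw [nsmul_eq_mul] at h₁ h₂
    linarith
  have hgap : f 0 - fbar ≤ g * (2 * (f 0 - fbar) / Cε) := by
    have hΔ : 0 ≤ f 0 - fbar := sub_nonneg.mpr hf0
    rw [← mul_div_assoc, le_div_iff₀ hC]
    nlinarith [mul_le_mul_of_nonneg_left hCg hΔ, mul_nonneg hΔ hg.le]
  have hn' := mul_le_mul_of_nonneg_left hn hg.le
  have hBK : g * (B * K) ≤ g * (B * NC.card) := by
    have hslack : 0 ≤ g * r * NC.card := by positivity
    rw [← hcard] at hn'
    rw [hB'] at hn' ⊢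
    linarith
  have hBpos : 0 < B := by rw [hB']; positivity
  exact_mod_cast le_of_mul_le_mul_left (le_of_mul_le_mul_left hBK hg) hBpos
end

section
/- Let A > 0, B ≥ 1, C > 0, δ ∈ (0,1), and let η ≥ 2 be an integer. If the real number K satisfies K ≥ max{C·log(1/δ), 4·C·η·A^{1/η}, 4·η²·C^{1+1/(η−1)}·B^{1/(η−1)}}, then K ≥ (C/2)·(log(A + B·K) + log(1/δ)). -/
theorem pow_add_pow_mul_le_exp {a b k : ℝ} (m : ℕ) (ha : 0 ≤ a) (hb : 0 ≤ b) (hk : 0 ≤ k)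
    (hak : 4 * (m + 2 : ℝ) * a ≤ k) (hbk : 4 * (m + 2 : ℝ) ^ 2 * b ≤ k) :
    a ^ (m + 2) + b ^ (m + 1) * k ≤ Real.exp k := by
  have hn : (2 : ℝ) ≤ m + 2 := by linarith [m.cast_nonneg (α := ℝ)]
  obtain ⟨t, rfl⟩ : ∃ t, k = (m + 2 : ℝ) * t := ⟨k / (m + 2), by field_simp⟩
  have ht : 0 ≤ t := by nlinarith
  have hat : a ≤ t / 4 := by nlinarith
  have hbt : 4 * (m + 2 : ℝ) * b ≤ t := by nlinarith
  have hexp : t ^ (m + 2) ≤ Real.exp ((m + 2 : ℝ) * t) := by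
    calc t ^ (m + 2) ≤ Real.exp t ^ (m + 2) := by
          gcongr
          linarith [Real.add_one_le_exp t]
      _ = Real.exp ((m + 2 : ℝ) * t) := by
          rw [← Real.exp_nat_mul]
          push_cast
          rfl
  have hfst : a ^ (m + 2) ≤ t ^ (m + 2) / 4 := by
    calc a ^ (m + 2) = a ^ (m + 1) * a := pow_succ _ _
      _ ≤ t ^ (m + 1) * (t / 4) := by
          gcongr
          linarith
      _ = t ^ (m + 2) / 4 := by ring
  have hsnd : b ^ (m + 1) * ((m + 2 : ℝ) * t) ≤ t ^ (m + 2) / 4 := by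
    have hle : b ≤ t := by nlinarith
    calc b ^ (m + 1) * ((m + 2 : ℝ) * t) = b ^ m * (4 * (m + 2 : ℝ) * b) * t / 4 := by ring
      _ ≤ t ^ m * t * t / 4 := by gcongr
      _ = t ^ (m + 2) / 4 := by ring
  have := pow_nonneg ht (m + 2)
  linarith

theorem K_choice_sufficient (A B C δ : ℝ) (hA : 0 < A) (hB : 1 ≤ B) (hC : 0 < C)
    (hδ₀ : 0 < δ) (hδ₁ : δ < 1) (η : ℕ) (hη : 2 ≤ η) (K : ℝ)
    (hK : max (C * Real.log (1/δ))
        (max (4 * C * η * A ^ ((1:ℝ)/η))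
          (4 * η^2 * C ^ (1 + (1:ℝ)/(η - 1)) * B ^ ((1:ℝ)/(η - 1)))) ≤ K) :
    (C/2) * (Real.log (A + B * K) + Real.log (1/δ)) ≤ K := by
  have hB0 : 0 < B := by linarith
  obtain ⟨hKδ, hKAB⟩ := max_le_iff.1 hK
  obtain ⟨hKA, hKB⟩ := max_le_iff.1 hKAB
  obtain ⟨m, rfl⟩ := Nat.exists_eq_add_of_le' hη
  obtain ⟨k, rfl⟩ : ∃ k, K = C * k := ⟨K / C, by field_simp⟩
  have hm : ((m + 2 : ℕ) : ℝ) - 1 = ((m + 1 : ℕ) : ℝ) := by push_cast; ring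
  rw [hm, Real.rpow_add hC, Real.rpow_one, mul_assoc, mul_assoc C,
    ← Real.mul_rpow hC.le hB0.le] at hKB
  have hApow : (A ^ ((1 : ℝ) / (m + 2 : ℕ))) ^ (m + 2) = A := by
    rw [one_div, Real.rpow_inv_natCast_pow hA.le (by lia)]
  have hCBpow : ((C * B) ^ ((1 : ℝ) / (m + 1 : ℕ))) ^ (m + 1) = C * B := by
    rw [one_div, Real.rpow_inv_natCast_pow (by positivity) (by lia)]
  have ha : 0 < A ^ ((1 : ℝ) / (m + 2 : ℕ)) := by positivity
  have hb : 0 < (C * B) ^ ((1 : ℝ) / (m + 1 : ℕ)) := by positivity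
  generalize A ^ ((1 : ℝ) / (m + 2 : ℕ)) = a at *
  generalize (C * B) ^ ((1 : ℝ) / (m + 1 : ℕ)) = b at *
  push_cast at hKA hKB
  have hak : 4 * (m + 2 : ℝ) * a ≤ k := le_of_mul_le_mul_left (by linarith) hC
  have hbk : 4 * (m + 2 : ℝ) ^ 2 * b ≤ k := le_of_mul_le_mul_left (by linarith) hC
  have hk : 0 ≤ k := le_trans (by positivity) hak
  have hexp := pow_add_pow_mul_le_exp m ha.le hb.le hk hak hbk
  rw [hApow, hCBpow] at hexp
  have hlog : Real.log (A + B * (C * k)) ≤ k := by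
    rw [Real.log_le_iff_le_exp (by positivity)]
    linarith
  have hlogδ : Real.log (1 / δ) ≤ k := le_of_mul_le_mul_left hKδ hC
  nlinarith
end
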